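/- Let n ≥ 1 and let φ : ℝⁿ → ℝⁿ be a smooth diffeomorphism with smooth inverse and everywhere invertible derivative Dφ; write ℓ_φ = log|det Dφ|. Let S^{ij}, S̄^{ab} : ℝⁿ → ℝ be smooth, symmetric in their indices, related by S̄^{ab}(φ(x)) = ∑_{i,j} ∂_i φ^a(x) ∂_j φ^b(x) S^{ij}(x), and let Π^k_{ij}, Π̄^c_{ab} be smooth arrays symmetric in the lower indices related by Π^k_{ij}(x) = ∑_{a,b,c} ∂_i φ^a ∂_j φ^b Π̄^c_{ab}(φ(x)) [(Dφ(x))^{-1}]^k_c + 𝔖(φ)^k_{ij}(x), with 𝔖(φ)^k_{ij} = ∑_σ ∂_i∂_j φ^σ (Dφ)^{-1}{}^k_σ − (1/(n+1))(δ^k_i ∂_j ℓ_φ + δ^k_j ∂_i ℓ_φ). Define γ^i := ((n+1)/(n+3))·( ∑_j ∂_j S^{ij} + ∑_{j,k} S^{jk} Π^i_{jk} ) and γ̄^a := ((n+1)/(n+3))·( ∑_b ∂_b S̄^{ab} + ∑_{b,c} S̄^{bc} Π̄^a_{bc} ). Then γ transforms as an upper connection in the bundle of volume forms over S: for all x and a,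 γ̄^a(φ(x)) = ∑_i ∂_i φ^a(x)·( γ^i(x) + ∑_j S^{ij}(x) ∂_j ℓ_φ(x) ). -/

import Mathlib

/-- Partial derivative `∂ᵢ g (x)` of a scalar function on `ℝⁿ`. -/
noncomputable def pd {n : ℕ} (g : (Fin n → ℝ) → ℝ) (i : Fin n) (x : Fin n → ℝ) : ℝ :=
  fderiv ℝ g x (Pi.single i 1)

/-- Jacobian matrix `(Df(x))^σ_i = ∂ᵢ f^σ (x)`. -/
noncomputable def jac {n : ℕ} (f : (Fin n → ℝ) → Fin n → ℝ) (x : Fin n → ℝ) :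
    Matrix (Fin n) (Fin n) ℝ :=
  fun σ i => pd (fun y => f y σ) i x

/-- `ℓ_f = log |det Df|`. -/
noncomputable def logJ {n : ℕ} (f : (Fin n → ℝ) → Fin n → ℝ) (x : Fin n → ℝ) : ℝ :=
  Real.log |(jac f x).det|

/-- Kronecker delta. -/
noncomputable def kdelta {n : ℕ} (i j : Fin n) : ℝ := if i = j then 1 else 0

/-- The multidimensional Schwarzian derivative
`𝔖(f)^k_{ij} = ∂ᵢ∂ⱼf^σ·[(Df)⁻¹]^k_σ − (1/(n+1))(δ^k_i ∂ⱼℓ_f + δ^k_j ∂ᵢℓ_f)`. -/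
noncomputable def schw {n : ℕ} (f : (Fin n → ℝ) → Fin n → ℝ) (x : Fin n → ℝ)
    (k i j : Fin n) : ℝ :=
  (∑ σ, pd (fun y => pd (fun z => f z σ) j y) i x * (jac f x)⁻¹ k σ)
    - (1 / ((n : ℝ) + 1)) *
      (kdelta k i * pd (logJ f) j x + kdelta k j * pd (logJ f) i x)

/-- The canonical upper-connection coefficients
`γ^i = ((n+1)/(n+3))·(∑ⱼ∂ⱼS^{ij} + ∑_{j,k}S^{jk}Π^i_{jk})`,
where `P k i j` stands for `Π^k_{ij}`. -/
noncomputable def upperConn {n : ℕ} (S : Fin n → Fin n → (Fin n → ℝ) → ℝ)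
    (P : Fin n → Fin n → Fin n → (Fin n → ℝ) → ℝ)
    (i : Fin n) (x : Fin n → ℝ) : ℝ :=
  (((n : ℝ) + 1) / ((n : ℝ) + 3)) *
    ((∑ j, pd (fun y => S i j y) j x) + ∑ j, ∑ k, S j k x * P i j k x)

/-- Jacobi's formula: the logarithmic derivative of a determinant is the trace of `A' A⁻¹`. -/
theorem Matrix.hasFDerivAt_log_det {E ι : Type*} [NormedAddCommGroup E] [NormedSpace ℝ E]
    [Fintype ι] [DecidableEq ι] {A : E → Matrix ι ι ℝ} {A' : ι → ι → E →L[ℝ] ℝ} {x : E}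
    (hA : ∀ i j, HasFDerivAt (fun y => A y i j) (A' i j) x) (hdet : IsUnit (A x).det) :
    HasFDerivAt (fun y => Real.log (A y).det) (∑ i, ∑ j, (A x)⁻¹ j i • A' i j) x := by
  let D : ContinuousMultilinearMap ℝ (fun _ : ι => ι → ℝ) ℝ :=
    ⟨(Matrix.detRowAlternating (n := ι) (R := ℝ)).toMultilinearMap,
      Continuous.matrix_det (A := fun M : ι → ι → ℝ => (M : Matrix ι ι ℝ)) continuous_id⟩
  have hA' : HasFDerivAt (fun y => (A y : ι → ι → ℝ))
      (ContinuousLinearMap.pi fun i => ContinuousLinearMap.pi fun j => A' i j) x :=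
    hasFDerivAt_pi.2 fun i => hasFDerivAt_pi.2 fun j => hA i j
  have hD : HasFDerivAt (fun y => (A y).det) _ x := (D.hasFDerivAt (A x)).comp x hA'
  convert hD.log hdet.ne_zero using 1
  ext v
  have hlin : (D.linearDeriv (A x)) (fun i j => A' i j v) =
      ∑ i, D (Function.update (A x) i fun j => A' i j v) :=
    D.linearDeriv_apply (fun i => A x i) (fun i j => A' i j v)
  have hsum (B : Matrix ι ι ℝ) :
      (∑ i, ∑ j, B j i • A' i j) v = ∑ i, ∑ j, B j i * A' i j v := by
    simp
  refine (hsum (A x)⁻¹).trans ?_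
  change _ = (A x).det⁻¹ * (D.linearDeriv (A x)) (fun i j => A' i j v)
  rw [hlin, Finset.mul_sum]
  refine Finset.sum_congr rfl fun i _ => ?_
  have hrow : D (Function.update (A x) i fun j => A' i j v) =
      ∑ j, A' i j v * (A x).adjugate j i := by
    change ((A x).updateRow i fun j => A' i j v).det = _
    rw [← Matrix.cramer_transpose_apply, Matrix.cramer_eq_adjugate_mulVec,
      ← Matrix.adjugate_transpose]
    simp [Matrix.mulVec, dotProduct, mul_comm]
  rw [hrow, Finset.mul_sum]
  refine Finset.sum_congr rfl fun j _ => ?_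
  rw [Matrix.inv_def, Ring.inverse_eq_inv]
  simp only [Matrix.smul_apply, smul_eq_mul]
  ring

theorem ContDiff.pd {n : ℕ} {g : (Fin n → ℝ) → ℝ} (hg : ContDiff ℝ (⊤ : ℕ∞) g) (i : Fin n) :
    ContDiff ℝ (⊤ : ℕ∞) (pd g i) :=
  (hg.fderiv_right (m := (⊤ : ℕ∞)) (by simp)).clm_apply contDiff_const

theorem ContDiff.hasFDerivAt_fderiv {n : ℕ} {g : (Fin n → ℝ) → ℝ}
    (hg : ContDiff ℝ (⊤ : ℕ∞) g) (x : Fin n → ℝ) : HasFDerivAt g (fderiv ℝ g x) x :=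
  (hg.differentiable (by simp) x).hasFDerivAt

theorem pd_comm {n : ℕ} {g : (Fin n → ℝ) → ℝ} (hg : ContDiff ℝ (⊤ : ℕ∞) g) (i j : Fin n)
    (x : Fin n → ℝ) : pd (pd g j) i x = pd (pd g i) j x := by
  have hd : DifferentiableAt ℝ (fderiv ℝ g) x :=
    (hg.fderiv_right (m := (⊤ : ℕ∞)) (by simp)).differentiable (by simp) x
  have key (i j : Fin n) : pd (pd g j) i x =
      fderiv ℝ (fderiv ℝ g) x (Pi.single i 1) (Pi.single j 1) := by
    change fderiv ℝ (fun y => fderiv ℝ g y (Pi.single j 1)) x _ = _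
    rw [fderiv_clm_apply hd (differentiableAt_const _)]
    simp
  rw [key, key]
  exact (hg.contDiffAt.isSymmSndFDerivAt (by
    simpa using WithTop.coe_le_coe.2 (le_top : (2 : ℕ∞) ≤ ⊤))) _ _

theorem pd_logJ {n : ℕ} {φ : (Fin n → ℝ) → Fin n → ℝ} (hφ : ContDiff ℝ (⊤ : ℕ∞) φ)
    {x : Fin n → ℝ} (hD : IsUnit (jac φ x).det) (j : Fin n) :
    pd (logJ φ) j x =
      ∑ σ, ∑ k, (jac φ x)⁻¹ k σ * pd (pd (fun y => φ y σ) k) j x := by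
  have h := Matrix.hasFDerivAt_log_det (A := jac φ) (x := x)
    (fun σ k => (((contDiff_pi.1 hφ σ).pd k).hasFDerivAt_fderiv x)) hD
  have hlog : logJ φ = fun y => Real.log (jac φ y).det := by
    ext y
    simp [logJ]
  rw [hlog, pd, h.fderiv]
  simp [pd]

/-- The chain rule for partial derivatives. -/
theorem pd_comp {n : ℕ} {g : (Fin n → ℝ) → ℝ} {φ : (Fin n → ℝ) → Fin n → ℝ}
    (hg : ContDiff ℝ (⊤ : ℕ∞) g) (hφ : ContDiff ℝ (⊤ : ℕ∞) φ) (k : Fin n) (x : Fin n → ℝ) :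
    pd (fun y => g (φ y)) k x = ∑ b, pd g b (φ x) * jac φ x b k := by
  have hφ' : HasFDerivAt φ (ContinuousLinearMap.pi fun b => fderiv ℝ (fun y => φ y b) x) x :=
    hasFDerivAt_pi.2 fun b => (contDiff_pi.1 hφ b).hasFDerivAt_fderiv x
  have h := (hg.hasFDerivAt_fderiv (φ x)).comp x hφ'
  rw [pd, show (fun y => g (φ y)) = g ∘ φ from rfl, h.fderiv]
  rw [ContinuousLinearMap.comp_apply, ← ContinuousLinearMap.coe_coe (fderiv ℝ g (φ x)),
    LinearMap.pi_apply_eq_sum_univ]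
  refine Finset.sum_congr rfl fun b _ => ?_
  have hb : (fun j => if b = j then (1 : ℝ) else 0) = Pi.single b 1 := by
    ext j
    simp [Pi.single_apply, eq_comm]
  rw [hb]
  simp [pd, jac, mul_comm]

theorem pd_sum_mul_mul {n : ℕ} {u v : Fin n → (Fin n → ℝ) → ℝ}
    {S : Fin n → Fin n → (Fin n → ℝ) → ℝ} (hu : ∀ i, ContDiff ℝ (⊤ : ℕ∞) (u i))
    (hv : ∀ i, ContDiff ℝ (⊤ : ℕ∞) (v i)) (hS : ∀ i j, ContDiff ℝ (⊤ : ℕ∞) (S i j))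
    (k : Fin n) (x : Fin n → ℝ) :
    pd (fun y => ∑ i, ∑ j, u i y * v j y * S i j y) k x =
      ∑ i, ∑ j, (pd (u i) k x * v j x * S i j x + u i x * pd (v j) k x * S i j x +
        u i x * v j x * pd (S i j) k x) := by
  have h := HasFDerivAt.fun_sum (u := Finset.univ) fun i _ =>
    HasFDerivAt.fun_sum (u := Finset.univ) fun j _ =>
    ((((hu i).hasFDerivAt_fderiv x).fun_mul ((hv j).hasFDerivAt_fderiv x)).fun_mul
      ((hS i j).hasFDerivAt_fderiv x))
  rw [pd, h.fderiv]
  simp only [sum_apply, add_apply,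
    smul_apply, smul_eq_mul]
  refine Finset.sum_congr rfl fun i _ => Finset.sum_congr rfl fun j _ => ?_
  simp only [pd]
  ring

/-- The divergence of a contravariant 2-tensor after a change of coordinates, as an identity
between finite sums: `J` is the Jacobian matrix, `K` its inverse, `h c k j` the second
derivatives, `s` the tensor, `ds i j k` its derivatives and `D c b` those of its image. -/
theorem sum_div_transform {ι : Type*} [Fintype ι] [DecidableEq ι] {J K : Matrix ι ι ℝ}
    (hJK : J * K = 1) (hKJ : K * J = 1) (u : ι → ℝ) (hu : ι → ι → ℝ) (h : ι → ι → ι → ℝ)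
    (s : ι → ι → ℝ) (ds : ι → ι → ι → ℝ) (D : ι → ι → ℝ)
    (hD : ∀ c k, ∑ b, D c b * J b k =
      ∑ i, ∑ j, (hu k i * J c j * s i j + u i * h c k j * s i j + u i * J c j * ds i j k)) :
    ∑ c, D c c = ∑ i, ∑ j, (hu j i * s i j + u i * s i j * (∑ c, ∑ k, K k c * h c k j) +
      u i * ds i j j) := by
  have hDc (c : ι) : D c c = ∑ k, (∑ b, D c b * J b k) * K k c := by
    have h1 : ((Matrix.of D * J) * K) c c = D c c := by
      rw [Matrix.mul_assoc, hJK, Matrix.mul_one, Matrix.of_apply]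
    rw [← h1]
    simp [Matrix.mul_apply]
  have hK (k j : ι) : ∑ c, K k c * J c j = if k = j then 1 else 0 := by
    rw [← Matrix.mul_apply, hKJ, Matrix.one_apply]
  have hswap (F : ι → ι → ι → ι → ℝ) :
      ∑ c, ∑ k, ∑ i, ∑ j, F c k i j = ∑ i, ∑ j, ∑ c, ∑ k, F c k i j := by
    simpa [Fintype.sum_prod_type] using Finset.sum_comm (s := Finset.univ) (t := Finset.univ)
      (f := fun (p : ι × ι) (q : ι × ι) => F p.1 p.2 q.1 q.2)
  simp only [hDc, hD, Finset.sum_mul]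
  rw [hswap]
  refine Finset.sum_congr rfl fun i _ => Finset.sum_congr rfl fun j _ => ?_
  calc _ = ∑ c, ∑ k, ((hu k i * s i j + u i * ds i j k) * (K k c * J c j) +
        u i * s i j * (K k c * h c k j)) := by
        refine Finset.sum_congr rfl fun c _ => Finset.sum_congr rfl fun k _ => ?_
        ring
    _ = ∑ k, (hu k i * s i j + u i * ds i j k) * (∑ c, K k c * J c j) +
        u i * s i j * (∑ c, ∑ k, K k c * h c k j) := by
        simp only [Finset.sum_add_distrib, Finset.mul_sum]
        rw [Finset.sum_comm]
    _ = _ := by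
        simp only [hK, mul_ite, mul_one, mul_zero, Finset.sum_ite_eq', Finset.mem_univ, if_true]
        ring

/-- Contracting the upper index of the transformation law of a projective class with the
Jacobian matrix removes the inverse Jacobian. -/
theorem sum_jac_mul_proj {n : ℕ} {φ : (Fin n → ℝ) → Fin n → ℝ} {x : Fin n → ℝ}
    (hD : IsUnit (jac φ x).det) (Q : Fin n → ℝ) (a i j : Fin n) :
    ∑ k, jac φ x a k * ((∑ c, Q c * (jac φ x)⁻¹ k c) + schw φ x k i j) =
      Q a + pd (pd (fun y => φ y a) j) i x - 1 / ((n : ℝ) + 1) *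
        (jac φ x a i * pd (logJ φ) j x + jac φ x a j * pd (logJ φ) i x) := by
  have hcontract (R : Fin n → ℝ) :
      ∑ k, jac φ x a k * (∑ c, R c * (jac φ x)⁻¹ k c) = R a := by
    have h1 : (jac φ x).mulVec ((jac φ x)⁻¹.mulVec R) a = R a := by
      rw [Matrix.mulVec_mulVec, Matrix.mul_nonsing_inv _ hD, Matrix.one_mulVec]
    rw [← h1]
    simp [Matrix.mulVec, dotProduct, mul_comm]
  have hdelta (l : Fin n) (t : ℝ) : ∑ k, jac φ x a k * (kdelta k l * t) = jac φ x a l * t := by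
    simp [kdelta]
  have hschw : ∑ k, jac φ x a k * schw φ x k i j =
      pd (pd (fun y => φ y a) j) i x - 1 / ((n : ℝ) + 1) *
        (jac φ x a i * pd (logJ φ) j x + jac φ x a j * pd (logJ φ) i x) := by
    rw [← hdelta i, ← hdelta j, ← hcontract (fun σ => pd (pd (fun y => φ y σ) j) i x),
      ← Finset.sum_add_distrib, Finset.mul_sum, ← Finset.sum_sub_distrib]
    refine Finset.sum_congr rfl fun k _ => ?_
    change _ * ((∑ σ, pd (pd (fun y => φ y σ) j) i x * (jac φ x)⁻¹ k σ) - _) = _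
    ring
  simp only [mul_add, Finset.sum_add_distrib]
  rw [hcontract, ← mul_add, hschw]
  ring

/-- The canonical coefficients
`γ^i = ((n+1)/(n+3))(∂ⱼS^{ij} + S^{jk}Π^i_{jk})` transform as an upper connection in
the bundle of volume forms over `S`:
`γ̄^a(φ(x)) = ∑ᵢ ∂ᵢφ^a(x)·(γ^i(x) + ∑ⱼ S^{ij}(x)∂ⱼℓ_φ(x))`. -/
theorem upper_connection_transformation {n : ℕ} (hn : 1 ≤ n)
    (φ φinv : (Fin n → ℝ) → Fin n → ℝ)
    (hφ : ContDiff ℝ (⊤ : ℕ∞) φ) (hφinv : ContDiff ℝ (⊤ : ℕ∞) φinv)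
    (hleft : Function.LeftInverse φinv φ) (hright : Function.RightInverse φinv φ)
    (hD : ∀ x, IsUnit (jac φ x).det)
    (S Sb : Fin n → Fin n → (Fin n → ℝ) → ℝ)
    (hS : ∀ i j, ContDiff ℝ (⊤ : ℕ∞) (S i j)) (hSb : ∀ a b, ContDiff ℝ (⊤ : ℕ∞) (Sb a b))
    (hSsym : ∀ i j, S i j = S j i) (hSbsym : ∀ a b, Sb a b = Sb b a)
    (hStrans : ∀ a b x, Sb a b (φ x) =
      ∑ i, ∑ j, pd (fun y => φ y a) i x * pd (fun y => φ y b) j x * S i j x)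
    (P Pb : Fin n → Fin n → Fin n → (Fin n → ℝ) → ℝ)
    (hP : ∀ k i j, ContDiff ℝ (⊤ : ℕ∞) (P k i j)) (hPb : ∀ c a b, ContDiff ℝ (⊤ : ℕ∞) (Pb c a b))
    (hPsym : ∀ k i j, P k i j = P k j i) (hPbsym : ∀ c a b, Pb c a b = Pb c b a)
    (hPtrans : ∀ k i j x, P k i j x =
      (∑ a, ∑ b, ∑ c, pd (fun y => φ y a) i x * pd (fun y => φ y b) j x *
          Pb c a b (φ x) * (jac φ x)⁻¹ k c) + schw φ x k i j)
    (x : Fin n → ℝ) (a : Fin n) :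
    upperConn Sb Pb a (φ x) =
      ∑ i, pd (fun y => φ y a) i x *
        (upperConn S P i x + ∑ j, S i j x * pd (logJ φ) j x) := by
  have hJK : jac φ x * (jac φ x)⁻¹ = 1 := Matrix.mul_nonsing_inv _ (hD x)
  have hKJ : (jac φ x)⁻¹ * jac φ x = 1 := Matrix.nonsing_inv_mul _ (hD x)
  have hφc := contDiff_pi.1 hφ
  have hjac (b i : Fin n) : pd (fun y => φ y b) i x = jac φ x b i := rfl
  have hlog (j : Fin n) : ∑ c, ∑ k, (jac φ x)⁻¹ k c * pd (pd (fun y => φ y c) j) k x =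
      pd (logJ φ) j x := by
    simp only [pd_logJ hφ (hD x), pd_comm (hφc _) j]
  have hdiv : ∑ c, pd (Sb a c) c (φ x) =
      ∑ i, ∑ j, (pd (pd (fun y => φ y a) i) j x * S i j x +
        jac φ x a i * S i j x * pd (logJ φ) j x + jac φ x a i * pd (S i j) j x) := by
    simp only [← hlog]
    refine sum_div_transform hJK hKJ (jac φ x a) (fun k i => pd (pd (fun y => φ y a) i) k x)
      (fun c k j => pd (pd (fun y => φ y c) j) k x) (fun i j => S i j x)
      (fun i j k => pd (S i j) k x) (fun c b => pd (Sb a c) b (φ x)) fun c k => ?_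
    rw [← pd_comp (hSb a c) hφ, funext (hStrans a c)]
    exact pd_sum_mul_mul (fun i => (hφc a).pd i) (fun i => (hφc c).pd i) hS k x
  have hcontr : ∑ b, ∑ c, Sb b c (φ x) * Pb a b c (φ x) =
      ∑ i, ∑ j, S i j x *
        ∑ b, ∑ c, jac φ x b i * jac φ x c j * Pb a b c (φ x) := by
    have hswap := Finset.sum_comm (s := Finset.univ) (t := Finset.univ)
      (f := fun (p : Fin n × Fin n) (q : Fin n × Fin n) =>
        S q.1 q.2 x * (jac φ x p.1 q.1 * jac φ x p.2 q.2 * Pb a p.1 p.2 (φ x)))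
    simp only [Fintype.sum_prod_type] at hswap
    simp only [Finset.mul_sum]
    rw [← hswap]
    refine Finset.sum_congr rfl fun b _ => Finset.sum_congr rfl fun c _ => ?_
    simp only [hStrans, Finset.sum_mul, hjac]
    refine Finset.sum_congr rfl fun i _ => Finset.sum_congr rfl fun j _ => ?_
    ring
  have hproj (i j : Fin n) : ∑ b, ∑ c, jac φ x b i * jac φ x c j * Pb a b c (φ x) =
      ∑ k, jac φ x a k * P k i j x - pd (pd (fun y => φ y a) j) i x + 1 / ((n : ℝ) + 1) *
        (jac φ x a i * pd (logJ φ) j x + jac φ x a j * pd (logJ φ) i x) := by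
    have h1 := sum_jac_mul_proj (hD x)
      (fun c => ∑ b, ∑ d, jac φ x b i * jac φ x d j * Pb c b d (φ x)) a i j
    have h2 (k : Fin n) : P k i j x = (∑ c, (∑ b, ∑ d, jac φ x b i * jac φ x d j *
        Pb c b d (φ x)) * (jac φ x)⁻¹ k c) + schw φ x k i j := by
      rw [hPtrans]
      congr 1
      simp only [Finset.sum_mul, hjac]
      rw [Finset.sum_comm_cycle, Finset.sum_comm_cycle]
    simp only [h2, h1]
    ring
  have hsymm (F : Fin n → Fin n → ℝ) :
      ∑ i, ∑ j, S i j x * F i j = ∑ i, ∑ j, S i j x * F j i := by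
    rw [Finset.sum_comm]
    exact Finset.sum_congr rfl fun i _ => Finset.sum_congr rfl fun j _ => by rw [hSsym]
  have hcancel : ((n : ℝ) + 1) / (n + 3) * (1 + 2 * (1 / ((n : ℝ) + 1))) = 1 := by
    have h1 : (n : ℝ) + 1 ≠ 0 := by positivity
    have h3 : (n : ℝ) + 3 ≠ 0 := by positivity
    field_simp
    ring
  have hSP : ∑ i, jac φ x a i * ∑ j, ∑ k, S j k x * P i j k x =
      ∑ i, ∑ j, S i j x * ∑ k, jac φ x a k * P k i j x := by
    simp only [Finset.mul_sum]
    rw [Finset.sum_comm_cycle, Finset.sum_comm_cycle]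
    exact Finset.sum_congr rfl fun i _ => Finset.sum_congr rfl fun j _ =>
      Finset.sum_congr rfl fun k _ => by ring
  have hbar : (∑ c, pd (Sb a c) c (φ x)) + ∑ b, ∑ c, Sb b c (φ x) * Pb a b c (φ x) =
      (∑ i, jac φ x a i * ∑ j, pd (S i j) j x) +
        (∑ i, jac φ x a i * ∑ j, ∑ k, S j k x * P i j k x) +
        (1 + 2 * (1 / ((n : ℝ) + 1))) *
          ∑ i, jac φ x a i * ∑ j, S i j x * pd (logJ φ) j x := by
    have hL := hsymm fun i j => jac φ x a i * pd (logJ φ) j x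
    have hL' : ∑ i, jac φ x a i * ∑ j, S i j x * pd (logJ φ) j x =
        ∑ i, ∑ j, S i j x * (jac φ x a i * pd (logJ φ) j x) := by
      simp only [Finset.mul_sum, mul_left_comm]
    have hH : ∑ i, ∑ j, pd (pd (fun y => φ y a) i) j x * S i j x =
        ∑ i, ∑ j, S i j x * pd (pd (fun y => φ y a) j) i x := by
      refine Finset.sum_congr rfl fun i _ => Finset.sum_congr rfl fun j _ => ?_
      rw [pd_comm (hφc a) j i, mul_comm]
    have hassoc : ∑ i, ∑ j, jac φ x a i * S i j x * pd (logJ φ) j x =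
        ∑ i, ∑ j, S i j x * (jac φ x a i * pd (logJ φ) j x) := by
      refine Finset.sum_congr rfl fun i _ => Finset.sum_congr rfl fun j _ => ?_
      ring
    rw [hdiv, hcontr, hSP, hL']
    simp only [hproj, mul_add, mul_sub, Finset.sum_add_distrib, Finset.sum_sub_distrib,
      mul_left_comm _ (1 / ((n : ℝ) + 1)), ← Finset.mul_sum]
    rw [← hL, hH, hassoc]
    ring
  simp only [hjac, mul_add, Finset.sum_add_distrib]
  change ((n : ℝ) + 1) / (n + 3) *
      ((∑ c, pd (Sb a c) c (φ x)) + ∑ b, ∑ c, Sb b c (φ x) * Pb a b c (φ x)) =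
    ∑ i, jac φ x a i * (((n : ℝ) + 1) / (n + 3) *
      ((∑ j, pd (S i j) j x) + ∑ j, ∑ k, S j k x * P i j k x)) + _
  rw [hbar, mul_add, ← mul_assoc, hcancel, one_mul, ← Finset.sum_add_distrib, Finset.mul_sum]
  congr 1
  exact Finset.sum_congr rfl fun i _ => by ring
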